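/- For every set of reals X (a subset of ℝ with the subspace topology), the following are equivalent: (a) X satisfies Ufin(Γ,Ω): for every sequence ⟨𝒰_n⟩_{n∈ℕ} of open covers of X, none containing a finite subcover, there exist finite subsets ℱ_n ⊆ 𝒰_n such that for every finite F ⊆ X there is n with F ⊆ ⋃ℱ_n; (b) X satisfies Sfin(Ω,O^{ω-gp}): for every sequence ⟨𝒰_n⟩_{n∈ℕ} of ω-covers of X there exist finite subsets ℱ_n ⊆ 𝒰_n such that ⋃_{n∈ℕ} ℱ_n is an ω-groupable cover of X. -/

import Mathlib

open Set Filter Topology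

/-- A (nontrivial) cover of a space: the union is everything and the whole space
is not a member. -/
def IsCover {α : Type*} (𝒰 : Set (Set α)) : Prop :=
  ⋃₀ 𝒰 = Set.univ ∧ Set.univ ∉ 𝒰

/-- An open cover: a cover all of whose members are open. -/
def IsOpenCover {α : Type*} [TopologicalSpace α] (𝒰 : Set (Set α)) : Prop :=
  IsCover 𝒰 ∧ ∀ U ∈ 𝒰, IsOpen U

/-- `𝒰` contains a finite subcover. -/
def HasFinSubcover {α : Type*} (𝒰 : Set (Set α)) : Prop :=
  ∃ ℱ ⊆ 𝒰, ℱ.Finite ∧ ⋃₀ ℱ = Set.univ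

/-- A γ-cover: an infinite open cover such that every point belongs to all but
finitely many members. -/
def IsGammaCover {α : Type*} [TopologicalSpace α] (𝒰 : Set (Set α)) : Prop :=
  IsOpenCover 𝒰 ∧ 𝒰.Infinite ∧ ∀ x : α, {U ∈ 𝒰 | x ∉ U}.Finite

/-- An ω-cover: an open cover such that every finite set is contained in some member. -/
def IsOmegaCover {α : Type*} [TopologicalSpace α] (𝒰 : Set (Set α)) : Prop :=
  IsOpenCover 𝒰 ∧ ∀ F : Set α, F.Finite → ∃ U ∈ 𝒰, F ⊆ U

/-- A large cover: an open cover such that every point belongs to infinitely many members. -/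
def IsLargeCover {α : Type*} [TopologicalSpace α] (𝒰 : Set (Set α)) : Prop :=
  IsOpenCover 𝒰 ∧ ∀ x : α, {U ∈ 𝒰 | x ∈ U}.Infinite

/-- A τ-cover: a large cover such that for all points `x, y`, one of the two
difference families is finite. -/
def IsTauCover {α : Type*} [TopologicalSpace α] (𝒰 : Set (Set α)) : Prop :=
  IsLargeCover 𝒰 ∧ ∀ x y : α,
    {U ∈ 𝒰 | x ∈ U ∧ y ∉ U}.Finite ∨ {U ∈ 𝒰 | y ∈ U ∧ x ∉ U}.Finite

/-- An ω-groupable cover: a cover admitting a partition into pairwise disjoint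
finite groups such that every finite set is contained in the union of some group. -/
def IsOmegaGroupable {α : Type*} (𝒰 : Set (Set α)) : Prop :=
  IsCover 𝒰 ∧ ∃ 𝒢 : ℕ → Set (Set α),
    (∀ k, (𝒢 k).Finite) ∧ (∀ k l, k ≠ l → Disjoint (𝒢 k) (𝒢 l)) ∧
    (⋃ k, 𝒢 k) = 𝒰 ∧ ∀ F : Set α, F.Finite → ∃ k, F ⊆ ⋃₀ 𝒢 k

theorem aux_infinite {α : Type*} [TopologicalSpace α] {𝒰 : Set (Set α)}
    (h : IsOmegaCover 𝒰) (x : α) : {U ∈ 𝒰 | x ∈ U}.Infinite := by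
  intro hfin
  have hne : ∀ U : Set α, ∃ y, U ∈ 𝒰 → y ∉ U := by
    intro U
    by_cases hU : U ∈ 𝒰
    · have : U ≠ Set.univ := fun e => h.1.1.2 (e ▸ hU)
      obtain ⟨y, hy⟩ := (Set.ne_univ_iff_exists_notMem U).1 this
      exact ⟨y, fun _ => hy⟩
    · exact ⟨x, fun h => absurd h hU⟩
  choose y hy using hne
  obtain ⟨V, hV, hFV⟩ := h.2 (insert x (y '' {U ∈ 𝒰 | x ∈ U})) ((hfin.image y).insert x)
  have hxV : x ∈ V := hFV (Set.mem_insert _ _)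
  exact hy V hV (hFV (Set.mem_insert_of_mem _ ⟨V, ⟨hV, hxV⟩, rfl⟩))

theorem aux_countable {α : Type*} [TopologicalSpace α] [SecondCountableTopology α]
    {𝒰 : Set (Set α)} (h : IsOmegaCover 𝒰) :
    ∃ W : ℕ → Set α, (∀ i, W i ∈ 𝒰) ∧
      ∀ (x : α) (S : Set (Set α)), S.Finite → ∃ i, x ∈ W i ∧ W i ∉ S := by
  have key : ∀ n : ℕ, ∃ T : Set {A : Finset (Set α) // ↑A ⊆ 𝒰 ∧ A.card = n}, T.Countable ∧
      ⋃ i ∈ T, ⋂₀ (i.1 : Set (Set α)) = ⋃ i : {A : Finset (Set α) // ↑A ⊆ 𝒰 ∧ A.card = n},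
        ⋂₀ (i.1 : Set (Set α)) := by
    intro n
    apply TopologicalSpace.isOpen_iUnion_countable
    intro i
    exact i.1.finite_toSet.isOpen_sInter fun U hU => h.1.2 U (i.2.1 hU)
  choose T hTc hT using key
  set W : Set (Set α) := ⋃ n, ⋃ i ∈ T n, (i.1 : Set (Set α)) with hW
  have hWc : W.Countable := Set.countable_iUnion fun n =>
    (hTc n).biUnion fun i _ => i.1.countable_toSet
  have hW𝒰 : W ⊆ 𝒰 := by
    intro U hU
    simp only [hW, Set.mem_iUnion] at hU
    obtain ⟨n, i, _, hi⟩ := hU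
    exact i.2.1 hi
  have hcov : ∀ (x : α) (S : Set (Set α)), S.Finite → ∃ U ∈ W, x ∈ U ∧ U ∉ S := by
    intro x S hS
    obtain ⟨A, hA, hAc⟩ := (aux_infinite h x).exists_subset_card_eq (hS.toFinset.card + 1)
    have hx : x ∈ ⋃ i : {A : Finset (Set α) // ↑A ⊆ 𝒰 ∧ A.card = hS.toFinset.card + 1},
        ⋂₀ (i.1 : Set (Set α)) := by
      refine Set.mem_iUnion.2 ⟨⟨A, fun U hU => (hA hU).1, hAc⟩, ?_⟩
      intro U hU
      exact (hA hU).2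
    rw [← hT] at hx
    simp only [Set.mem_iUnion] at hx
    obtain ⟨i, hi, hxi⟩ := hx
    obtain ⟨U, hU, hUS⟩ := Finset.exists_mem_notMem_of_card_lt_card
      (s := hS.toFinset) (t := i.1) (by rw [i.2.2]; omega)
    refine ⟨U, ?_, hxi U hU, by simpa using hUS⟩
    simp only [hW, Set.mem_iUnion]
    exact ⟨_, i, hi, hU⟩
  have hne : W.Nonempty := by
    obtain ⟨U, hU, -⟩ := h.2 ∅ Set.finite_empty
    have : U ≠ Set.univ := fun e => h.1.1.2 (e ▸ hU)
    obtain ⟨y, hy⟩ := (Set.ne_univ_iff_exists_notMem U).1 this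
    obtain ⟨V, hV, _⟩ := hcov y ∅ Set.finite_empty
    exact ⟨V, hV⟩
  obtain ⟨f, hf⟩ := hWc.exists_eq_range hne
  refine ⟨f, fun i => hW𝒰 (hf ▸ Set.mem_range_self i), ?_⟩
  intro x S hS
  obtain ⟨U, hU, hxU⟩ := hcov x S hS
  rw [hf] at hU
  obtain ⟨i, rfl⟩ := hU
  exact ⟨i, hxU⟩

theorem aux_bound {α : Type*} (V : ℕ → Set α) (hV : Monotone V) (A : Set (Set α))
    (hA : A.Finite) (hsub : A ⊆ Set.range V) : ∃ N, ⋃₀ A ⊆ V N := by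
  induction A, hA using Set.Finite.induction_on with
  | empty => exact ⟨0, by simp⟩
  | @insert a s _ _ ih =>
    obtain ⟨N, hN⟩ := ih ((Set.subset_insert _ _).trans hsub)
    obtain ⟨M, rfl⟩ := hsub (Set.mem_insert _ _)
    refine ⟨max M N, ?_⟩
    rw [Set.sUnion_insert]
    exact Set.union_subset (hV (le_max_left _ _)) (hN.trans (hV (le_max_right _ _)))

theorem aux_select {α : Type*} [TopologicalSpace α]
    (h : ∀ 𝒰 : ℕ → Set (Set α),
        (∀ n, IsOpenCover (𝒰 n) ∧ ¬ HasFinSubcover (𝒰 n)) →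
        ∃ ℱ : ℕ → Set (Set α), (∀ n, (ℱ n).Finite ∧ ℱ n ⊆ 𝒰 n) ∧
          ∀ F : Set α, F.Finite → ∃ n, F ⊆ ⋃₀ ℱ n)
    (V : ℕ → ℕ → Set α) (hopen : ∀ m N, IsOpen (V m N)) (hmono : ∀ m, Monotone (V m))
    (hanti : ∀ m m' N, m ≤ m' → V m' N ⊆ V m N) (hcov : ∀ m x, ∃ N, x ∈ V m N) :
    ∃ f : ℕ → ℕ, ∀ F : Set α, F.Finite → ∃ m, F ⊆ V m (f m) := by
  by_cases hc : ∀ m, ∃ N, V m N = Set.univ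
  · choose f hf using hc
    exact ⟨f, fun F _ => ⟨0, by rw [hf]; exact Set.subset_univ _⟩⟩
  push Not at hc
  obtain ⟨m0, hm0⟩ := hc
  have hne : ∀ m N, V (m0 + m) N ≠ Set.univ := fun m N e =>
    hm0 N (Set.univ_subset_iff.1 (e ▸ hanti m0 (m0 + m) N (Nat.le_add_right _ _)))
  obtain ⟨ℱ, hℱ, hF⟩ := h (fun m => Set.range (V (m0 + m))) (by
    intro m
    refine ⟨⟨⟨?_, ?_⟩, ?_⟩, ?_⟩
    · ext x
      obtain ⟨N, hN⟩ := hcov (m0 + m) x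
      simp only [Set.mem_sUnion, Set.mem_univ, iff_true]
      exact ⟨_, ⟨N, rfl⟩, hN⟩
    · rintro ⟨N, hN⟩
      exact hne m N hN
    · rintro _ ⟨N, rfl⟩
      exact hopen _ _
    · rintro ⟨A, hA, hAf, hAu⟩
      obtain ⟨N, hN⟩ := aux_bound _ (hmono (m0 + m)) A hAf hA
      exact hne m N (Set.univ_subset_iff.1 (hAu ▸ hN)))
  have := fun m => aux_bound _ (hmono (m0 + m)) (ℱ m) (hℱ m).1 (hℱ m).2
  choose f hf using this
  refine ⟨f, fun F hFf => ?_⟩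
  obtain ⟨m, hm⟩ := hF F hFf
  exact ⟨m, (hm.trans (hf m)).trans (hanti _ _ _ (Nat.le_add_left _ _))⟩

theorem aux_forward {α : Type*} [TopologicalSpace α] [SecondCountableTopology α]
    (h : ∀ 𝒰 : ℕ → Set (Set α),
        (∀ n, IsOpenCover (𝒰 n) ∧ ¬ HasFinSubcover (𝒰 n)) →
        ∃ ℱ : ℕ → Set (Set α), (∀ n, (ℱ n).Finite ∧ ℱ n ⊆ 𝒰 n) ∧
          ∀ F : Set α, F.Finite → ∃ n, F ⊆ ⋃₀ ℱ n)
    (𝒰 : ℕ → Set (Set α)) (h𝒰 : ∀ n, IsOmegaCover (𝒰 n)) :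
    ∃ ℱ : ℕ → Set (Set α), (∀ n, (ℱ n).Finite ∧ ℱ n ⊆ 𝒰 n) ∧
          IsOmegaGroupable (⋃ n, ℱ n) := by
  choose U hU hUc using fun n => aux_countable (h𝒰 n)
  let R : ℕ → Set (Set α) := fun m => {W | ∃ j l, j ≤ m ∧ l < m ∧ W = U j l}
  have hRfin : ∀ m, (R m).Finite := by
    intro m
    refine (((Set.finite_Iic m).prod (Set.finite_Iio m)).image
      (fun p : ℕ × ℕ => U p.1 p.2)).subset ?_
    rintro _ ⟨j, l, hj, hl, rfl⟩
    exact ⟨(j, l), ⟨hj, hl⟩, rfl⟩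
  have hRmono : ∀ m m', m ≤ m' → R m ⊆ R m' := by
    rintro m m' hm _ ⟨j, l, hj, hl, rfl⟩
    exact ⟨j, l, by omega, by omega, rfl⟩
  let V : ℕ → ℕ → Set α := fun m N =>
    {x | ∀ n ≤ m, ∃ i < N, x ∈ U n i ∧ U n i ∉ R m}
  have hVmono : ∀ m, Monotone (V m) := by
    intro m N N' hN x hx n hn
    obtain ⟨i, hi, hxi⟩ := hx n hn
    exact ⟨i, by omega, hxi⟩
  have hVanti : ∀ m m' N, m ≤ m' → V m' N ⊆ V m N := by
    intro m m' N hm x hx n hn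
    obtain ⟨i, hi, hxi, hxR⟩ := hx n (by omega)
    exact ⟨i, hi, hxi, fun hc => hxR (hRmono _ _ hm hc)⟩
  have hVopen : ∀ m N, IsOpen (V m N) := by
    intro m N
    have : V m N = ⋂ n ∈ Set.Iic m, ⋃ i ∈ {i | i < N ∧ U n i ∉ R m}, U n i := by
      ext x
      simp only [V, Set.mem_ofPred_eq, Set.mem_iInter, Set.mem_iUnion, Set.mem_Iic, exists_prop]
      refine forall₂_congr fun n hn => exists_congr fun i => by tauto
    rw [this]
    refine (Set.finite_Iic m).isOpen_biInter fun n _ => isOpen_biUnion fun i _ => ?_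
    exact (h𝒰 n).1.2 _ (hU n i)
  have hVcov : ∀ m x, ∃ N, x ∈ V m N := by
    intro m x
    choose i hi using fun n => hUc n x (R m) (hRfin m)
    refine ⟨(Finset.range (m + 1)).sup i + 1, fun n hn => ⟨i n, ?_, hi n⟩⟩
    have : i n ≤ (Finset.range (m + 1)).sup i :=
      Finset.le_sup (f := i) (by simp; omega)
    omega
  obtain ⟨f, hf⟩ := aux_select h V hVopen hVmono hVanti hVcov
  -- make the selector monotone
  let g : ℕ → ℕ := fun m => (Finset.range (m + 1)).sup f + m + 1
  have hgf : ∀ m m', m ≤ m' → f m ≤ g m' := by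
    intro m m' hm
    have : f m ≤ (Finset.range (m' + 1)).sup f := Finset.le_sup (f := f) (by simp; omega)
    simp only [g]; omega
  have hgm : ∀ m, m < g m := by intro m; simp only [g]; omega
  let s : ℕ → ℕ := fun k => g^[k] 0
  have hs0 : s 0 = 0 := rfl
  have hs : ∀ k, s (k + 1) = g (s k) := fun k => Function.iterate_succ_apply' g k 0
  have hsm : StrictMono s := strictMono_nat_of_lt_succ fun k => by rw [hs]; exact hgm _
  have hsk : ∀ k, k ≤ s k := fun _ => hsm.le_apply
  have hgood : ∀ F : Set α, F.Finite → ∃ k, F ⊆ V (s k) (s (k + 2)) := by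
    intro F hF
    obtain ⟨m, hm⟩ := hf F hF
    have hex : ∃ k, m < s (k + 1) := ⟨m, by have := hsk (m + 1); omega⟩
    classical
    have h1 := Nat.find_spec hex
    have h2 : s (Nat.find hex) ≤ m := by
      rcases hk : Nat.find hex with _ | k
      · rw [hs0]; omega
      · have := Nat.find_min hex (m := k) (by omega)
        omega
    refine ⟨Nat.find hex, (hm.trans (hVanti _ _ _ h2)).trans (hVmono _ ?_)⟩
    rw [show Nat.find hex + 2 = (Nat.find hex + 1) + 1 from rfl, hs]
    exact hgf _ _ h1.le
  have hpar : ∃ e, ∀ F : Set α, F.Finite → ∃ k, k % 2 = e ∧ F ⊆ V (s k) (s (k + 2)) := by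
    by_contra hcon
    push Not at hcon
    obtain ⟨F0, hF0, h0⟩ := hcon 0
    obtain ⟨F1, hF1, h1⟩ := hcon 1
    obtain ⟨k, hk⟩ := hgood (F0 ∪ F1) (hF0.union hF1)
    rcases Nat.mod_two_eq_zero_or_one k with hk0 | hk1
    · exact h0 k hk0 (Set.subset_union_left.trans hk)
    · exact h1 k hk1 (Set.subset_union_right.trans hk)
  obtain ⟨e, he⟩ := hpar
  let ℱ : ℕ → Set (Set α) := fun n =>
    {W | n % 2 = e ∧ (∃ i < s (n + 2), W = U n i) ∧ W ∉ R (s n)}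
  have hℱcov : ∀ F : Set α, F.Finite → ∃ k, F ⊆ ⋃₀ ℱ k := by
    intro F hF
    obtain ⟨k, hke, hk⟩ := he F hF
    refine ⟨k, fun x hx => ?_⟩
    obtain ⟨i, hi, hxi, hR⟩ := hk hx k (hsk k)
    exact ⟨U k i, ⟨hke, ⟨i, hi, rfl⟩, hR⟩, hxi⟩
  have hℱsub : ∀ n, ℱ n ⊆ 𝒰 n := by
    rintro n _ ⟨_, ⟨i, _, rfl⟩, _⟩
    exact hU n i
  have hℱfin : ∀ n, (ℱ n).Finite := by
    intro n
    refine ((Set.finite_Iio (s (n + 2))).image (U n)).subset ?_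
    rintro _ ⟨_, ⟨i, hi, rfl⟩, _⟩
    exact ⟨i, hi, rfl⟩
  have hdis : ∀ k l, k < l → Disjoint (ℱ k) (ℱ l) := by
    intro k l hkl
    rw [Set.disjoint_left]
    rintro _ ⟨hk, ⟨i, hi, rfl⟩, _⟩ ⟨hl, _, hR⟩
    apply hR
    have h1 : s (k + 2) ≤ s l := hsm.monotone (by omega)
    have h2 := hsk l
    exact ⟨k, i, by omega, by omega, rfl⟩
  refine ⟨ℱ, fun n => ⟨hℱfin n, hℱsub n⟩, ⟨?_, ?_⟩, ℱ, hℱfin, ?_, rfl, hℱcov⟩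
  · ext x
    obtain ⟨k, hk⟩ := hℱcov {x} (Set.finite_singleton x)
    obtain ⟨W, hW, hxW⟩ := hk rfl
    simp only [Set.mem_univ, iff_true]
    exact ⟨W, Set.mem_iUnion.2 ⟨k, hW⟩, hxW⟩
  · intro hu
    obtain ⟨n, hn⟩ := Set.mem_iUnion.1 hu
    exact (h𝒰 n).1.1.2 (hℱsub n hn)
  · intro k l hkl
    rcases lt_or_gt_of_ne hkl with hlt | hlt
    · exact hdis k l hlt
    · exact (hdis l k hlt).symm

theorem aux_backward {α : Type*} [TopologicalSpace α]
    (h : ∀ 𝒰 : ℕ → Set (Set α), (∀ n, IsOmegaCover (𝒰 n)) →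
        ∃ ℱ : ℕ → Set (Set α), (∀ n, (ℱ n).Finite ∧ ℱ n ⊆ 𝒰 n) ∧
          IsOmegaGroupable (⋃ n, ℱ n))
    (𝒰 : ℕ → Set (Set α)) (h𝒰 : ∀ n, IsOpenCover (𝒰 n) ∧ ¬ HasFinSubcover (𝒰 n)) :
    ∃ ℱ : ℕ → Set (Set α), (∀ n, (ℱ n).Finite ∧ ℱ n ⊆ 𝒰 n) ∧
          ∀ F : Set α, F.Finite → ∃ n, F ⊆ ⋃₀ ℱ n := by
  let 𝒱 : ℕ → Set (Set α) := fun n =>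
    {V | IsOpen V ∧ ∀ j ≤ n, ∃ A ⊆ 𝒰 j, A.Finite ∧ V ⊆ ⋃₀ A}
  have hfincov : ∀ n (F : Set α), F.Finite → ∃ A ⊆ 𝒰 n, A.Finite ∧ F ⊆ ⋃₀ A := by
    intro n F hF
    have : ∀ x, ∃ W ∈ 𝒰 n, x ∈ W := fun x => by
      have hx : x ∈ ⋃₀ 𝒰 n := by rw [(h𝒰 n).1.1.1]; trivial
      exact hx
    choose W hW hxW using this
    refine ⟨W '' F, ?_, hF.image W, fun x hx => ⟨W x, ⟨x, hx, rfl⟩, hxW x⟩⟩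
    rintro _ ⟨x, _, rfl⟩
    exact hW x
  have hom : ∀ n (F : Set α), F.Finite → ∃ V ∈ 𝒱 n, F ⊆ V := by
    intro n F hF
    choose A hA hAf hFA using fun j => hfincov j F hF
    refine ⟨⋂ j ∈ Set.Iic n, ⋃₀ A j, ⟨?_, ?_⟩, ?_⟩
    · refine (Set.finite_Iic n).isOpen_biInter fun j _ => isOpen_sUnion fun W hW => ?_
      exact (h𝒰 j).1.2 W (hA j hW)
    · intro j hj
      exact ⟨A j, hA j, hAf j, Set.biInter_subset_of_mem hj⟩
    · exact Set.subset_iInter₂ fun j _ => hFA j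
  obtain ⟨ℱ, hℱ, hcov, 𝒢, h𝒢f, h𝒢d, h𝒢u, h𝒢⟩ := h 𝒱 (by
    intro n
    refine ⟨⟨⟨?_, ?_⟩, fun V hV => hV.1⟩, hom n⟩
    · ext x
      obtain ⟨V, hV, hx⟩ := hom n {x} (Set.finite_singleton x)
      simp only [Set.mem_univ, iff_true]
      exact ⟨V, hV, hx rfl⟩
    · intro hu
      obtain ⟨A, hA, hAf, hAu⟩ := hu.2 n le_rfl
      exact (h𝒰 n).2 ⟨A, hA, hAf, Set.univ_subset_iff.1 hAu⟩)
  have hK : ∀ n, ∃ K, (n = 0 → K = 0) ∧ ∀ k ≥ K, 𝒢 k ⊆ 𝒱 n := by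
    intro n
    have hkey : ∀ k, (∀ W ∈ ⋃ j ∈ Set.Iio n, ℱ j, W ∉ 𝒢 k) → 𝒢 k ⊆ 𝒱 n := by
      intro k hk W hW
      have hWu : W ∈ ⋃ n, ℱ n := h𝒢u ▸ Set.mem_iUnion.2 ⟨k, hW⟩
      obtain ⟨j, hj⟩ := Set.mem_iUnion.1 hWu
      have hnj : n ≤ j := by
        by_contra hlt
        exact hk W (Set.mem_biUnion (show j ∈ Set.Iio n from not_le.1 hlt) hj) hW
      have := (hℱ j).2 hj
      exact ⟨this.1, fun i hi => this.2 i (hi.trans hnj)⟩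
    rcases Nat.eq_zero_or_pos n with rfl | hn
    · exact ⟨0, fun _ => rfl, fun k _ => hkey k (by simp)⟩
    · have hS : (⋃ j ∈ Set.Iio n, ℱ j).Finite :=
        (Set.finite_Iio n).biUnion fun j _ => (hℱ j).1
      have : ∀ᶠ k in atTop, ∀ W ∈ ⋃ j ∈ Set.Iio n, ℱ j, W ∉ 𝒢 k := by
        rw [Filter.eventually_all_finite hS]
        intro W _
        by_cases hex : ∃ k, W ∈ 𝒢 k
        · obtain ⟨k0, hk0⟩ := hex
          filter_upwards [eventually_gt_atTop k0] with k hk hWk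
          exact Set.disjoint_left.1 (h𝒢d k0 k (by omega)) hk0 hWk
        · push Not at hex
          exact Filter.Eventually.of_forall hex
      obtain ⟨K, hK⟩ := eventually_atTop.1 this
      exact ⟨K, fun h0 => by omega, fun k hk => hkey k (hK k hk)⟩
  choose K hK0 hK using hK
  have hA : ∀ n (W : Set α), ∃ A, (A ⊆ 𝒰 n ∧ A.Finite) ∧ (W ∈ 𝒱 n → W ⊆ ⋃₀ A) := by
    intro n W
    by_cases hW : W ∈ 𝒱 n
    · obtain ⟨A, hA, hAf, hWA⟩ := hW.2 n le_rfl
      exact ⟨A, ⟨hA, hAf⟩, fun _ => hWA⟩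
    · exact ⟨∅, ⟨Set.empty_subset _, Set.finite_empty⟩, fun h => absurd h hW⟩
  choose A hA hWA using hA
  refine ⟨fun n => ⋃ k ∈ Set.Iio (max (n + 1) (K (n + 1))), ⋃ W ∈ 𝒢 k, A n W, ?_, ?_⟩
  · intro n
    refine ⟨(Set.finite_Iio _).biUnion fun k _ => (h𝒢f k).biUnion fun W _ => (hA n W).2, ?_⟩
    exact Set.iUnion₂_subset fun k _ => Set.iUnion₂_subset fun W _ => (hA n W).1
  · intro F hF
    obtain ⟨k, hk⟩ := h𝒢 F hF
    have hex : ∃ n, k < max (n + 1) (K (n + 1)) := ⟨k, by omega⟩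
    classical
    have h1 := Nat.find_spec hex
    have h2 : K (Nat.find hex) ≤ k := by
      rcases hn : Nat.find hex with _ | n
      · rw [hK0 0 rfl]; omega
      · have := Nat.find_min hex (m := n) (by omega)
        omega
    refine ⟨Nat.find hex, fun x hx => ?_⟩
    obtain ⟨W, hW, hxW⟩ := hk hx
    obtain ⟨B, hB, hxB⟩ := hWA _ W (hK _ k h2 hW) hxW
    exact ⟨B, Set.mem_biUnion (show k ∈ Set.Iio _ from h1) (Set.mem_biUnion hW hB), hxB⟩

/-- For sets of reals, `Ufin(Γ,Ω)` is equivalent to `Sfin(Ω,O^{ω-gp})`. -/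
theorem ufin_gamma_omega_iff_sfin_omega_omegagroupable (X : Set ℝ) :
    (∀ 𝒰 : ℕ → Set (Set X),
        (∀ n, IsOpenCover (𝒰 n) ∧ ¬ HasFinSubcover (𝒰 n)) →
        ∃ ℱ : ℕ → Set (Set X), (∀ n, (ℱ n).Finite ∧ ℱ n ⊆ 𝒰 n) ∧
          ∀ F : Set X, F.Finite → ∃ n, F ⊆ ⋃₀ ℱ n) ↔
    (∀ 𝒰 : ℕ → Set (Set X), (∀ n, IsOmegaCover (𝒰 n)) →
        ∃ ℱ : ℕ → Set (Set X), (∀ n, (ℱ n).Finite ∧ ℱ n ⊆ 𝒰 n) ∧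
          IsOmegaGroupable (⋃ n, ℱ n)) := by
  exact ⟨aux_forward, aux_backward⟩
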